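/- If f : (0,∞) → ℝ is an entropic function, then for every finite-dimensional Hilbert space the map (ρ, h) ↦ Tr h* (df'(ρ)) h is convex in pairs (ρ, h) of a positive definite operator ρ and a self-adjoint operator h; that is, f is a matrix entropy. -/

import Mathlib

open scoped Matrix
open Matrix
open scoped ComplexOrder

noncomputable section

/-- The trace of `f` applied (by the functional calculus) to a Hermitian matrix,
computed via the eigenvalues.  Junk value `0` on non-Hermitian matrices. -/
def trFn (f : ℝ → ℝ) {d : Type} [Fintype d] [DecidableEq d] (ρ : Matrix d d ℂ) : ℝ :=
  if hρ : ρ.IsHermitian then ∑ i, f (hρ.eigenvalues i) else 0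

/-- `f` applied to a Hermitian matrix by the functional calculus (spectral theorem).
Junk value `0` on non-Hermitian matrices. -/
def matFn (f : ℝ → ℝ) {d : Type} [Fintype d] [DecidableEq d] (ρ : Matrix d d ℂ) :
    Matrix d d ℂ :=
  if hρ : ρ.IsHermitian then
    (hρ.eigenvectorUnitary : Matrix d d ℂ) *
      Matrix.diagonal (fun i => (f (hρ.eigenvalues i) : ℂ)) *
      star (hρ.eigenvectorUnitary : Matrix d d ℂ)
  else 0

/-- The partial trace over the second factor of a bipartite system `H₁ ⊗ H₂`,
where operators on `H₁ ⊗ H₂` are modelled as matrices indexed by `Fin m × Fin n`. -/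
def partialTrace {m n : ℕ} (ρ : Matrix (Fin m × Fin n) (Fin m × Fin n) ℂ) :
    Matrix (Fin m) (Fin m) ℂ :=
  Matrix.of fun i j => ∑ k : Fin n, ρ (i, k) (j, k)

/-- A convex function `f : (0,∞) → ℝ` is entropic if on every finite-dimensional
bipartite system the map `ρ ↦ -Tr f(ρ₁) + Tr f(ρ)` is convex in positive definite `ρ`,
where `ρ₁` is the partial trace of `ρ` on the first factor. -/
def IsEntropic (f : ℝ → ℝ) : Prop :=
  ConvexOn ℝ (Set.Ioi (0 : ℝ)) f ∧
  ∀ m n : ℕ,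
    ConvexOn ℝ {ρ : Matrix (Fin m × Fin n) (Fin m × Fin n) ℂ | ρ.PosDef}
      (fun ρ => - trFn f (partialTrace ρ) + trFn f ρ)

/-- A convex function `f : (0,∞) → ℝ` is subentropic of order `k` if
`G(ρ₁,…,ρ_k) = -Tr f(ρ₁+⋯+ρ_k) + Tr f(ρ₁) + ⋯ + Tr f(ρ_k)` is convex in `k`-tuples of
positive definite operators on any finite-dimensional Hilbert space. -/
def SubentropicOfOrder (f : ℝ → ℝ) (k : ℕ) : Prop :=
  ConvexOn ℝ (Set.Ioi (0 : ℝ)) f ∧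
  ∀ n : ℕ,
    ConvexOn ℝ {ρ : Fin k → Matrix (Fin n) (Fin n) ℂ | ∀ i, (ρ i).PosDef}
      (fun ρ => - trFn f (∑ i, ρ i) + ∑ i, trFn f (ρ i))

/-- A function is subentropic if it is subentropic of all orders. -/
def Subentropic (f : ℝ → ℝ) : Prop :=
  ∀ k : ℕ, SubentropicOfOrder f k

/-- Divided difference of `g`, with `g'` on the diagonal. -/
def divDiff (g : ℝ → ℝ) (x y : ℝ) : ℝ :=
  if x = y then deriv g x else (g x - g y) / (x - y)

/-- Conjugation `h ↦ U * h * U*` as a linear operator on matrices. -/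
def conjEnd {n : ℕ} (U : Matrix (Fin n) (Fin n) ℂ) :
    Module.End ℂ (Matrix (Fin n) (Fin n) ℂ) :=
  (LinearMap.mulLeft ℂ U).comp (LinearMap.mulRight ℂ (star U))

/-- Hadamard (entrywise) multiplication by a fixed matrix `L`, as a linear operator. -/
def hadamardEnd {n : ℕ} (L : Matrix (Fin n) (Fin n) ℂ) :
    Module.End ℂ (Matrix (Fin n) (Fin n) ℂ) where
  toFun h := L ⊙ h
  map_add' h₁ h₂ := Matrix.hadamard_add L h₁ h₂
  map_smul' c h := Matrix.hadamard_smul L h c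

/-- The Fréchet differential `dg(ρ)` of the matrix function induced by `g` at the
Hermitian matrix `ρ`: in a basis diagonalising `ρ` it acts as the Hadamard product
with the Löwner matrix of divided differences of `g`.  Junk value `0` at
non-Hermitian matrices. -/
def frechetDiff (g : ℝ → ℝ) {n : ℕ} (ρ : Matrix (Fin n) (Fin n) ℂ) :
    Module.End ℂ (Matrix (Fin n) (Fin n) ℂ) :=
  if hρ : ρ.IsHermitian then
    (conjEnd (hρ.eigenvectorUnitary : Matrix (Fin n) (Fin n) ℂ)).comp
      ((hadamardEnd (Matrix.of fun i j =>
          (divDiff g (hρ.eigenvalues i) (hρ.eigenvalues j) : ℂ))).comp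
        (conjEnd (star (hρ.eigenvectorUnitary : Matrix (Fin n) (Fin n) ℂ))))
  else 0

/-- The order, with respect to the trace inner product, between operators on `B(H)`:
`T ≤ S` iff `S - T` is a positive superoperator. -/
def endLE {n : ℕ} (T S : Module.End ℂ (Matrix (Fin n) (Fin n) ℂ)) : Prop :=
  ∀ h : Matrix (Fin n) (Fin n) ℂ, 0 ≤ Matrix.trace (star h * (S h - T h))

/-- The harmonic mean `H₂(A,B) = 2 (A⁻¹ + B⁻¹)⁻¹` of two (positive definite, hence
invertible) operators on `B(H)`. -/
def harmonicMeanEnd {n : ℕ} (A B : Module.End ℂ (Matrix (Fin n) (Fin n) ℂ)) :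
    Module.End ℂ (Matrix (Fin n) (Fin n) ℂ) :=
  (2 : ℂ) • Ring.inverse (Ring.inverse A + Ring.inverse B)

/-- The amplification `id_n ⊗ Φ` of a linear map on matrices. -/
def amplify {m k : ℕ} (Φ : Matrix (Fin m) (Fin m) ℂ →ₗ[ℂ] Matrix (Fin k) (Fin k) ℂ)
    (n : ℕ) (A : Matrix (Fin n × Fin m) (Fin n × Fin m) ℂ) :
    Matrix (Fin n × Fin k) (Fin n × Fin k) ℂ :=
  Matrix.of fun p q => Φ (Matrix.of fun x y => A (p.1, x) (q.1, y)) p.2 q.2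

/-- A linear map on matrices is completely positive if all its amplifications
preserve positive semidefiniteness. -/
def IsCompletelyPositive {m k : ℕ}
    (Φ : Matrix (Fin m) (Fin m) ℂ →ₗ[ℂ] Matrix (Fin k) (Fin k) ℂ) : Prop :=
  ∀ n : ℕ, ∀ A : Matrix (Fin n × Fin m) (Fin n × Fin m) ℂ,
    A.PosSemidef → (amplify Φ n A).PosSemidef

/-- A quantum channel is a completely positive trace preserving linear map. -/
def IsQuantumChannel {m k : ℕ}
    (Φ : Matrix (Fin m) (Fin m) ℂ →ₗ[ℂ] Matrix (Fin k) (Fin k) ℂ) : Prop :=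
  IsCompletelyPositive Φ ∧ ∀ A, (Φ A).trace = A.trace

section

open Filter Topology Set

theorem tendsto_symm_second_difference {φ φ' : ℝ → ℝ} {x c : ℝ}
    (h1 : ∀ᶠ y in 𝓝 x, HasDerivAt φ (φ' y) y) (h2 : HasDerivAt φ' c x) :
    Tendsto (fun t => (φ (x + t) + φ (x - t) - 2 * φ x) / t ^ 2) (𝓝[>] 0) (𝓝 c) := by
  have hp : Tendsto (fun t : ℝ => x + t) (𝓝[>] 0) (𝓝 x) := by
    have : Tendsto (fun t : ℝ => x + t) (𝓝 0) (𝓝 (x + 0)) := Continuous.tendsto (by fun_prop) 0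
    rw [add_zero] at this
    exact this.mono_left nhdsWithin_le_nhds
  have hm : Tendsto (fun t : ℝ => x - t) (𝓝[>] 0) (𝓝 x) := by
    have : Tendsto (fun t : ℝ => x - t) (𝓝 0) (𝓝 (x - 0)) := Continuous.tendsto (by fun_prop) 0
    rw [sub_zero] at this
    exact this.mono_left nhdsWithin_le_nhds
  have hφ : ContinuousAt φ x := h1.self_of_nhds.continuousAt
  refine HasDerivAt.lhopital_zero_nhdsGT (f' := fun t => φ' (x + t) - φ' (x - t))
    (g' := fun t => 2 * t) ?_ ?_ ?_ ?_ ?_ ?_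
  · filter_upwards [hp.eventually h1, hm.eventually h1] with t ht1 ht2
    have e1 := ht1.comp_const_add x t
    have e2 := ht2.comp_const_sub x t
    simpa [sub_eq_add_neg] using (e1.add e2).sub_const (2 * φ x)
  · filter_upwards with t
    simpa using hasDerivAt_pow 2 t
  · filter_upwards [self_mem_nhdsWithin] with t ht
    exact mul_ne_zero two_ne_zero (ne_of_gt ht)
  · have := ((hφ.tendsto.comp hp).add (hφ.tendsto.comp hm)).sub_const (2 * φ x)
    simpa [two_mul] using this
  · have : Tendsto (fun t : ℝ => t ^ 2) (𝓝 0) (𝓝 (0 ^ 2)) := Continuous.tendsto (by fun_prop) 0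
    simpa using this.mono_left nhdsWithin_le_nhds
  · have hs := hasDerivAt_iff_tendsto_slope.1 h2
    have e1 : Tendsto (fun t : ℝ => x + t) (𝓝[>] 0) (𝓝[≠] x) :=
      tendsto_nhdsWithin_iff.2 ⟨hp, by
        filter_upwards [self_mem_nhdsWithin] with t ht
        simpa using (ne_of_gt ht)⟩
    have e2 : Tendsto (fun t : ℝ => x - t) (𝓝[>] 0) (𝓝[≠] x) :=
      tendsto_nhdsWithin_iff.2 ⟨hm, by
        filter_upwards [self_mem_nhdsWithin] with t ht
        simpa using (ne_of_gt ht)⟩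
    have := ((hs.comp e1).add (hs.comp e2)).div_const 2
    have hc : (c + c) / 2 = c := by ring
    rw [hc] at this
    refine this.congr' ?_
    filter_upwards [self_mem_nhdsWithin] with t ht
    have ht' : t ≠ 0 := ne_of_gt ht
    simp only [Function.comp, slope_def_field]
    have : x - t - x = -t := by ring
    rw [this, add_sub_cancel_left, div_neg, ← sub_eq_add_neg, ← sub_div, div_div, mul_comm t 2]
    congr 1
    ring

theorem nonpos_of_frequently_pos_second_difference {u : ℝ → ℝ} {a b : ℝ} {t : ℕ → ℝ}
    (ht : Tendsto t atTop (𝓝 0)) (hu : ContinuousOn u (Icc a b)) (ha : u a = 0) (hb : u b = 0)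
    (h : ∀ x ∈ Ioo a b, ∃ᶠ k in atTop, 0 < u (x + t k) + u (x - t k) - 2 * u x) :
    ∀ x ∈ Icc a b, u x ≤ 0 := by
  intro x hx
  obtain ⟨x₀, hx₀, hmax⟩ := isCompact_Icc.exists_isMaxOn ⟨x, hx⟩ hu
  refine (hmax hx).trans ?_
  by_contra! hpos
  have hxa : a ≠ x₀ := by rintro rfl; simp [ha] at hpos
  have hxb : x₀ ≠ b := by rintro rfl; simp [hb] at hpos
  have hI : x₀ ∈ Ioo a b := ⟨lt_of_le_of_ne hx₀.1 hxa, lt_of_le_of_ne hx₀.2 hxb⟩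
  have hp : Tendsto (fun k => x₀ + t k) atTop (𝓝 x₀) := by simpa using ht.const_add x₀
  have hm : Tendsto (fun k => x₀ - t k) atTop (𝓝 x₀) := by simpa using ht.const_sub x₀
  have hN : Icc a b ∈ 𝓝 x₀ := Icc_mem_nhds hI.1 hI.2
  obtain ⟨k, hk, h1, h2⟩ := ((h x₀ hI).and_eventually
    ((hp.eventually_mem hN).and (hm.eventually_mem hN))).exists
  have h1 := hmax h1
  have h2 := hmax h2
  simp only [mem_ofPred_eq] at h1 h2
  linarith

theorem eqOn_chord_of_tendsto_second_difference {D : ℝ → ℝ} {a b : ℝ} (hab : a < b)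
    {t : ℕ → ℝ} (ht : Tendsto t atTop (𝓝 0)) (ht0 : ∀ k, 0 < t k)
    (hD : ContinuousOn D (Icc a b))
    (h : ∀ x ∈ Ioo a b,
      Tendsto (fun k => (D (x + t k) + D (x - t k) - 2 * D x) / t k ^ 2) atTop (𝓝 0)) :
    ∀ x ∈ Icc a b, D x = D a + (D b - D a) / (b - a) * (x - a) := by
  have hba : b - a ≠ 0 := by linarith
  set m := (D b - D a) / (b - a) with hm
  have hmb : m * (b - a) = D b - D a := by rw [hm]; field_simp
  have key : ∀ s : ℝ, ∀ ε > 0, ∀ x ∈ Icc a b,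
      s * (D x - (D a + m * (x - a))) + ε * ((x - a) * (x - b)) ≤ 0 := by
    intro s ε hε
    refine nonpos_of_frequently_pos_second_difference (t := t) ht ?_ ?_ ?_ ?_
    · fun_prop
    · ring
    · rw [hmb]; ring
    · intro x hx
      have h1 := (h x hx).const_mul s
      rw [mul_zero] at h1
      refine Eventually.frequently ?_
      filter_upwards [h1.eventually_const_lt (show -(2 * ε) < 0 by linarith)] with k hk
      have h2 := mul_lt_mul_of_pos_right hk (pow_pos (ht0 k) 2)
      rw [mul_assoc, div_mul_cancel₀ _ (pow_pos (ht0 k) 2).ne'] at h2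
      nlinarith
  intro x hx
  have lim : ∀ s : ℝ, s * (D x - (D a + m * (x - a))) ≤ 0 := by
    intro s
    have h1 : Tendsto (fun ε : ℝ => s * (D x - (D a + m * (x - a))) + ε * ((x - a) * (x - b)))
        (𝓝[>] 0) (𝓝 (s * (D x - (D a + m * (x - a))))) := by
      have : Tendsto (fun ε : ℝ => s * (D x - (D a + m * (x - a))) + ε * ((x - a) * (x - b)))
        (𝓝 0) (𝓝 (s * (D x - (D a + m * (x - a))) + 0 * ((x - a) * (x - b)))) :=
        Continuous.tendsto (by fun_prop) 0
      simpa using this.mono_left nhdsWithin_le_nhds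
    refine le_of_tendsto h1 ?_
    filter_upwards [self_mem_nhdsWithin] with ε hε
    exact key s ε hε x hx
  have h1 := lim 1
  have h2 := lim (-1)
  linarith

/-- A convex function whose symmetric second differences are convex is twice continuously
differentiable. -/
theorem exists_continuousOn_deriv2_of_convexOn_second_difference {f : ℝ → ℝ}
    (hf : ConvexOn ℝ (Ioi 0) f)
    (hQ : ∀ h > 0, ConvexOn ℝ (Ioi h) (fun x => f (x + h) + f (x - h) - 2 * f x)) :
    ∃ q : ℝ → ℝ, ContinuousOn q (Ioi 0) ∧
      ∀ x > 0, DifferentiableAt ℝ f x ∧ HasDerivAt (deriv f) (q x) x := by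
  set t : ℕ → ℝ := fun k => (1 / 2) ^ k with ht_def
  have ht0 : ∀ k, 0 < t k := fun k => by positivity
  have ht : Tendsto t atTop (𝓝 0) :=
    tendsto_pow_atTop_nhds_zero_of_lt_one (by norm_num) (by norm_num)
  have htw : Tendsto t atTop (𝓝[>] 0) :=
    tendsto_nhdsWithin_iff.2 ⟨ht, Eventually.of_forall ht0⟩
  set S : ℕ → ℝ → ℝ := fun k x => (f (x + t k) + f (x - t k) - 2 * f x) / t k ^ 2 with hS
  have hSconv : ∀ k, ConvexOn ℝ (Ioi (t k)) (S k) := by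
    intro k
    have := (hQ (t k) (ht0 k)).smul (inv_nonneg.2 (sq_nonneg (t k)))
    refine this.congr fun x _ => ?_
    simp [hS, div_eq_inv_mul]
  have hSnonneg : ∀ k x, t k < x → 0 ≤ S k x := by
    intro k x hx
    have := hf.2 (show x + t k ∈ Ioi 0 by have := ht0 k; simp; linarith)
      (show x - t k ∈ Ioi 0 by simp; linarith)
      (show (0:ℝ) ≤ 1/2 by norm_num) (show (0:ℝ) ≤ 1/2 by norm_num) (by norm_num)
    simp only [smul_eq_mul] at this
    have e : 1 / 2 * (x + t k) + 1 / 2 * (x - t k) = x := by ring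
    rw [e] at this
    refine div_nonneg ?_ (by positivity)
    linarith
  have hSanti : ∀ k x, t k < x → S (k + 1) x ≤ S k x := by
    intro k x hx
    have htk : t k = 2 * t (k + 1) := by simp only [ht_def, pow_succ]; ring
    set s := t (k + 1) with hs
    have hs0 : 0 < s := ht0 _
    have := (hQ s hs0).2 (show x + s ∈ Ioi s by simp; linarith)
      (show x - s ∈ Ioi s by simp; linarith)
      (show (0:ℝ) ≤ 1/2 by norm_num) (show (0:ℝ) ≤ 1/2 by norm_num) (by norm_num)
    simp only [smul_eq_mul] at this
    have e : 1 / 2 * (x + s) + 1 / 2 * (x - s) = x := by ring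
    rw [e] at this
    have e1 : x + s + s = x + 2 * s := by ring
    have e2 : x - s - s = x - 2 * s := by ring
    rw [e1, e2, add_sub_cancel_right, sub_add_cancel] at this
    simp only [hS]
    rw [htk, ← hs, div_le_div_iff₀ (by positivity) (by positivity)]
    nlinarith [sq_nonneg s]
  have hlim : ∀ x > 0, ∃ L, Tendsto (fun k => S k x) atTop (𝓝 L) := by
    intro x hx
    obtain ⟨K, hK⟩ := (ht.eventually_lt_const hx).exists_forall_of_atTop
    have hanti : Antitone (fun k => S (k + K) x) := antitone_nat_of_succ_le fun k => by
      rw [add_right_comm]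
      exact hSanti _ _ (hK _ (by omega))
    have hbdd : BddBelow (range fun k => S (k + K) x) :=
      ⟨0, by rintro _ ⟨k, rfl⟩; exact hSnonneg _ _ (hK _ (by omega))⟩
    exact ⟨_, (tendsto_add_atTop_iff_nat K).1 (tendsto_atTop_ciInf hanti hbdd)⟩
  choose! q hq using hlim
  have hqconv : ConvexOn ℝ (Ioi 0) q := by
    refine ⟨convex_Ioi 0, fun x hx y hy a b ha hb hab => ?_⟩
    refine le_of_tendsto_of_tendsto (hq _ (convex_Ioi (0:ℝ) hx hy ha hb hab))
      (((hq x hx).const_mul a).add ((hq y hy).const_mul b)) ?_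
    filter_upwards [ht.eventually_lt_const hx, ht.eventually_lt_const hy] with k h1 h2
    exact (hSconv k).2 h1 h2 ha hb hab
  have hqc : ContinuousOn q (Ioi 0) := hqconv.continuousOn isOpen_Ioi
  refine ⟨q, hqc, ?_⟩
  have prim : ∀ {g : ℝ → ℝ}, ContinuousOn g (Ioi 0) → ∀ x > 0,
      HasDerivAt (fun y => ∫ s in (1:ℝ)..y, g s) (g x) x := by
    intro g hg x hx
    have hsub : uIcc 1 x ⊆ Ioi 0 := fun y hy => lt_of_lt_of_le (lt_min one_pos hx) hy.1
    exact intervalIntegral.integral_hasDerivAt_right (hg.mono hsub).intervalIntegrable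
      (hg.stronglyMeasurableAtFilter isOpen_Ioi x hx) (hg.continuousAt (Ioi_mem_nhds hx))
  set P₁ : ℝ → ℝ := fun y => ∫ s in (1:ℝ)..y, q s with hP₁
  have hP₁d : ∀ x > 0, HasDerivAt P₁ (q x) x := prim hqc
  have hP₁c : ContinuousOn P₁ (Ioi 0) := fun x hx => (hP₁d x hx).continuousAt.continuousWithinAt
  set P : ℝ → ℝ := fun y => ∫ s in (1:ℝ)..y, P₁ s with hP
  have hPd : ∀ x > 0, HasDerivAt P (P₁ x) x := prim hP₁c
  have hPc : ContinuousOn P (Ioi 0) := fun x hx => (hPd x hx).continuousAt.continuousWithinAt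
  have hfc : ContinuousOn f (Ioi 0) := hf.continuousOn isOpen_Ioi
  intro x₀ hx₀
  have hsub : Icc (x₀ / 2) (2 * x₀) ⊆ Ioi 0 := fun y hy => by
    have := hy.1; simp only [mem_Ioi]; linarith
  have hD := eqOn_chord_of_tendsto_second_difference (D := fun x => f x - P x)
    (show x₀ / 2 < 2 * x₀ by linarith) ht ht0 ((hfc.sub hPc).mono hsub) (by
      intro x hx
      have hx0 : 0 < x := hsub (Ioo_subset_Icc_self hx)
      have h1 := (tendsto_symm_second_difference (φ := P) (φ' := P₁) (x := x) (c := q x)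
        (by filter_upwards [Ioi_mem_nhds hx0] with y hy using hPd y hy) (hP₁d x hx0)).comp htw
      have h2 := (hq x hx0).sub h1
      rw [sub_self] at h2
      refine h2.congr fun k => ?_
      simp only [hS, Function.comp]
      ring)
  set m := (f (2 * x₀) - P (2 * x₀) - (f (x₀ / 2) - P (x₀ / 2))) / (2 * x₀ - x₀ / 2)
  have hfd : ∀ x ∈ Ioo (x₀ / 2) (2 * x₀), HasDerivAt f (P₁ x + m) x := by
    intro x hx
    have hx0 : 0 < x := hsub (Ioo_subset_Icc_self hx)
    have h1 : HasDerivAt (fun x => P x + (f (x₀ / 2) - P (x₀ / 2) + m * (x - x₀ / 2)))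
        (P₁ x + m) x := by
      have := (((hasDerivAt_id x).sub_const (x₀ / 2)).const_mul m).const_add
        (f (x₀ / 2) - P (x₀ / 2))
      simpa using (hPd x hx0).fun_add this
    refine h1.congr_of_eventuallyEq ?_
    filter_upwards [Icc_mem_nhds hx.1 hx.2] with y hy
    have := hD y hy
    linarith
  have hmem : x₀ ∈ Ioo (x₀ / 2) (2 * x₀) := ⟨by linarith, by linarith⟩
  refine ⟨(hfd x₀ hmem).differentiableAt, ?_⟩
  refine ((hP₁d x₀ hx₀).add_const m).congr_of_eventuallyEq ?_
  filter_upwards [Ioo_mem_nhds hmem.1 hmem.2] with y hy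
  exact (hfd y hy).deriv

theorem trFn_eq_sum_of_charpoly {d ι : Type} [Fintype d] [DecidableEq d] [Fintype ι]
    (f : ℝ → ℝ) {A : Matrix d d ℂ} (hA : A.IsHermitian) {x : ι → ℝ}
    (h : A.charpoly = ∏ i, (Polynomial.X - Polynomial.C (x i : ℂ))) :
    trFn f A = ∑ i, f (x i) := by
  have h1 := hA.roots_charpoly_eq_eigenvalues
  have h2 : (∏ i, (Polynomial.X - Polynomial.C (x i : ℂ))).roots
      = Multiset.map (fun i => (x i : ℂ)) Finset.univ.val := by
    have := Polynomial.roots_multiset_prod_X_sub_C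
      (Multiset.map (fun i => (x i : ℂ)) Finset.univ.val)
    rwa [Multiset.map_map] at this
  rw [h, h2] at h1
  have h3 := congrArg (Multiset.map (fun z : ℂ => f z.re)) h1
  simp only [Multiset.map_map, Function.comp_def, Complex.ofReal_re] at h3
  rw [trFn, dif_pos hA]
  exact (congrArg Multiset.sum h3).symm

theorem trFn_congr_charpoly {d e : Type} [Fintype d] [DecidableEq d] [Fintype e] [DecidableEq e]
    (f : ℝ → ℝ) {A : Matrix d d ℂ} {B : Matrix e e ℂ} (hA : A.IsHermitian) (hB : B.IsHermitian)
    (h : A.charpoly = B.charpoly) : trFn f A = trFn f B := by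
  rw [trFn_eq_sum_of_charpoly f hA (x := hB.eigenvalues) (h.trans hB.charpoly_eq), trFn,
    dif_pos hB]

theorem trFn_diagonal {d : Type} [Fintype d] [DecidableEq d] (f : ℝ → ℝ) (x : d → ℝ) :
    trFn f (diagonal fun i => (x i : ℂ)) = ∑ i, f (x i) :=
  trFn_eq_sum_of_charpoly f (isHermitian_diagonal_iff.2 fun i => by
    simp [IsSelfAdjoint]) (charpoly_diagonal _)

theorem charpoly_star_conj {d : Type} [Fintype d] [DecidableEq d] {U : Matrix d d ℂ}
    (hU : U ∈ unitaryGroup d ℂ) (A : Matrix d d ℂ) : (star U * A * U).charpoly = A.charpoly := by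
  rw [charpoly_mul_comm, ← mul_assoc, mem_unitaryGroup_iff.1 hU, one_mul]

theorem trFn_star_conj {d : Type} [Fintype d] [DecidableEq d] (f : ℝ → ℝ) {U : Matrix d d ℂ}
    (hU : U ∈ unitaryGroup d ℂ) {A : Matrix d d ℂ} (hA : A.IsHermitian) :
    trFn f (star U * A * U) = trFn f A :=
  trFn_congr_charpoly f (isHermitian_conjTranspose_mul_mul U hA) hA (charpoly_star_conj hU A)

theorem star_eigenvectorUnitary_conj {d : Type} [Fintype d] [DecidableEq d]
    {A : Matrix d d ℂ} (hA : A.IsHermitian) :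
    star (hA.eigenvectorUnitary : Matrix d d ℂ) * A * (hA.eigenvectorUnitary : Matrix d d ℂ)
      = diagonal fun i => (hA.eigenvalues i : ℂ) := by
  have := hA.conjStarAlgAut_star_eigenvectorUnitary
  rw [Unitary.conjStarAlgAut_apply] at this
  simpa [Function.comp_def] using this

theorem eq_eigenvectorUnitary_conj {d : Type} [Fintype d] [DecidableEq d]
    {A : Matrix d d ℂ} (hA : A.IsHermitian) :
    A = (hA.eigenvectorUnitary : Matrix d d ℂ) * (diagonal fun i => (hA.eigenvalues i : ℂ))
      * star (hA.eigenvectorUnitary : Matrix d d ℂ) := by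
  have := hA.spectral_theorem
  rw [Unitary.conjStarAlgAut_apply] at this
  exact this

/-- The diagonal of a Hermitian matrix in any orthonormal basis is the image of its spectrum
under a doubly stochastic matrix. -/
theorem exists_doublyStochastic_diag {d : Type} [Fintype d] [DecidableEq d]
    {A : Matrix d d ℂ} (hA : A.IsHermitian) {V : Matrix d d ℂ} (hV : V ∈ unitaryGroup d ℂ) :
    ∃ w : d → d → ℝ, (∀ i j, 0 ≤ w i j) ∧ (∀ j, ∑ i, w i j = 1) ∧ (∀ i, ∑ j, w i j = 1) ∧
      ∀ j, ((star V * A * V) j j).re = ∑ i, w i j * hA.eigenvalues i := by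
  set U := hA.eigenvectorUnitary with hU
  set W : Matrix d d ℂ := star (U : Matrix d d ℂ) * V with hW
  have hWm : W ∈ unitaryGroup d ℂ := mul_mem (star U).2 hV
  have h1 : star W * W = 1 := mem_unitaryGroup_iff'.1 hWm
  have h2 : W * star W = 1 := mem_unitaryGroup_iff.1 hWm
  refine ⟨fun i j => Complex.normSq (W i j), fun i j => Complex.normSq_nonneg _, fun j => ?_,
    fun i => ?_, fun j => ?_⟩
  · have := congrArg Complex.re (congrFun (congrFun h1 j) j)
    simpa [mul_apply, star_apply, Complex.normSq_apply] using this
  · have := congrArg Complex.re (congrFun (congrFun h2 i) i)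
    simpa [mul_apply, star_apply, Complex.normSq_apply] using this
  · have : star V * A * V = star W * (diagonal fun i => (hA.eigenvalues i : ℂ)) * W := by
      conv_lhs => rw [eq_eigenvectorUnitary_conj hA]
      simp only [hW, star_mul, star_star, mul_assoc, ← hU]
    rw [this]
    rw [mul_apply, Complex.re_sum]
    refine Finset.sum_congr rfl fun i _ => ?_
    rw [mul_diagonal, star_apply]
    simp only [RCLike.star_def, Complex.mul_re, Complex.mul_im, Complex.conj_re, Complex.conj_im,
      Complex.ofReal_re, Complex.ofReal_im, Complex.normSq_apply]
    ring

theorem trFn_midpoint_le {d : Type} [Fintype d] [DecidableEq d] {φ : ℝ → ℝ} {s : Set ℝ}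
    (hφ : ConvexOn ℝ s φ) {A B C : Matrix d d ℂ} (hA : A.IsHermitian) (hB : B.IsHermitian)
    (hC : C.IsHermitian) (hAs : ∀ i, hA.eigenvalues i ∈ s) (hBs : ∀ i, hB.eigenvalues i ∈ s)
    (h : A + B = (2 : ℝ) • C) : 2 * trFn φ C ≤ trFn φ A + trFn φ B := by
  set V := (hC.eigenvectorUnitary : Matrix d d ℂ) with hV
  have peierls : ∀ {M : Matrix d d ℂ} (hM : M.IsHermitian) (hMs : ∀ i, hM.eigenvalues i ∈ s),
      (∀ j, ((star V * M * V) j j).re ∈ s) ∧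
        ∑ j, φ ((star V * M * V) j j).re ≤ trFn φ M := by
    intro M hM hMs
    obtain ⟨w, hw0, hw1, hw2, hw⟩ := exists_doublyStochastic_diag hM hC.eigenvectorUnitary.2
    refine ⟨fun j => ?_, ?_⟩
    · rw [hw j]
      exact hφ.1.sum_mem (fun i _ => hw0 i j) (hw1 j) fun i _ => hMs i
    · calc ∑ j, φ ((star V * M * V) j j).re
          ≤ ∑ j, ∑ i, w i j * φ (hM.eigenvalues i) := Finset.sum_le_sum fun j _ => by
            rw [hw j]
            exact hφ.map_sum_le (fun i _ => hw0 i j) (hw1 j) fun i _ => hMs i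
        _ = trFn φ M := by
            rw [Finset.sum_comm, trFn, dif_pos hM]
            exact Finset.sum_congr rfl fun i _ => by rw [← Finset.sum_mul, hw2, one_mul]
  obtain ⟨hA1, hA2⟩ := peierls hA hAs
  obtain ⟨hB1, hB2⟩ := peierls hB hBs
  refine le_trans ?_ (add_le_add hA2 hB2)
  rw [trFn, dif_pos hC, Finset.mul_sum, ← Finset.sum_add_distrib]
  refine Finset.sum_le_sum fun j _ => ?_
  have hj : ((star V * A * V) j j).re + ((star V * B * V) j j).re = 2 * hC.eigenvalues j := by
    have e : star V * A * V + star V * B * V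
        = (2 : ℝ) • diagonal fun i => (hC.eigenvalues i : ℂ) := by
      rw [← add_mul, ← mul_add, h, ← star_eigenvectorUnitary_conj hC, mul_smul_comm,
        smul_mul_assoc]
    have := congrArg Complex.re (congrFun (congrFun e j) j)
    simpa using this
  have := hφ.2 (hA1 j) (hB1 j) (show (0:ℝ) ≤ 1/2 by norm_num) (show (0:ℝ) ≤ 1/2 by norm_num)
    (by norm_num)
  simp only [smul_eq_mul] at this
  rw [← mul_add, hj, one_div, inv_mul_cancel_left₀ two_ne_zero] at this
  linarith

theorem le_eigenvalues_iff {d : Type} [Fintype d] [DecidableEq d] {A : Matrix d d ℂ}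
    (hA : A.IsHermitian) (a : ℝ) :
    (∀ i, a ≤ hA.eigenvalues i) ↔ (A - a • (1 : Matrix d d ℂ)).PosSemidef := by
  have hU : IsUnit (hA.eigenvectorUnitary : Matrix d d ℂ) :=
    (Unitary.toUnits hA.eigenvectorUnitary).isUnit
  have : star (hA.eigenvectorUnitary : Matrix d d ℂ) * (A - a • (1 : Matrix d d ℂ)) *
      (hA.eigenvectorUnitary : Matrix d d ℂ)
      = diagonal fun i => ((hA.eigenvalues i - a : ℝ) : ℂ) := by
    rw [mul_sub, sub_mul, star_eigenvectorUnitary_conj hA]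
    ext i j
    by_cases hij : i = j <;> simp [hij, one_apply]
  rw [← hU.posSemidef_star_left_conjugate_iff, this, posSemidef_diagonal_iff]
  simp only [Complex.zero_le_real, sub_nonneg]

theorem eigenvalues_le_iff {d : Type} [Fintype d] [DecidableEq d] {A : Matrix d d ℂ}
    (hA : A.IsHermitian) (b : ℝ) :
    (∀ i, hA.eigenvalues i ≤ b) ↔ (b • (1 : Matrix d d ℂ) - A).PosSemidef := by
  have hU : IsUnit (hA.eigenvectorUnitary : Matrix d d ℂ) :=
    (Unitary.toUnits hA.eigenvectorUnitary).isUnit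
  have : star (hA.eigenvectorUnitary : Matrix d d ℂ) * (b • (1 : Matrix d d ℂ) - A) *
      (hA.eigenvectorUnitary : Matrix d d ℂ)
      = diagonal fun i => ((b - hA.eigenvalues i : ℝ) : ℂ) := by
    rw [mul_sub, sub_mul, star_eigenvectorUnitary_conj hA]
    ext i j
    by_cases hij : i = j <;> simp [hij, one_apply]
  rw [← hU.posSemidef_star_left_conjugate_iff, this, posSemidef_diagonal_iff]
  simp only [Complex.zero_le_real, sub_nonneg]

theorem isHermitian_add_smul {d : Type} {A H : Matrix d d ℂ}
    (hA : A.IsHermitian) (hH : H.IsHermitian) (t : ℝ) : (A + t • H).IsHermitian :=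
  hA.add (hH.smul (IsSelfAdjoint.all t))

/-- Small Hermitian perturbations of a positive definite matrix have spectrum in a fixed compact
subinterval of `(0, ∞)`. -/
theorem exists_Icc_eigenvalues_add_smul {d : Type} [Fintype d] [DecidableEq d]
    {A H : Matrix d d ℂ} (hA : A.PosDef) (hH : H.IsHermitian) :
    ∃ a b : ℝ, 0 < a ∧ a < b ∧ (∀ i, hA.1.eigenvalues i ∈ Icc a b) ∧ ∀ᶠ t : ℝ in 𝓝[>] 0,
      (∀ i, (isHermitian_add_smul hA.1 hH t).eigenvalues i ∈ Icc a b) ∧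
      ∀ i, (isHermitian_add_smul hA.1 hH (-t)).eigenvalues i ∈ Icc a b := by
  obtain ⟨a, ha, ha0⟩ : ∃ a : ℝ, (∀ i, a < hA.1.eigenvalues i) ∧ 0 < a := by
    have h1 : ∀ᶠ a : ℝ in 𝓝[>] 0, ∀ i, a < hA.1.eigenvalues i := by
      rw [eventually_all]
      intro i
      exact (eventually_lt_nhds (hA.eigenvalues_pos i)).filter_mono nhdsWithin_le_nhds
    exact (h1.and self_mem_nhdsWithin).exists
  obtain ⟨b, hb, hab⟩ : ∃ b : ℝ, (∀ i, hA.1.eigenvalues i < b) ∧ a < b := by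
    have h1 : ∀ᶠ b : ℝ in atTop, ∀ i, hA.1.eigenvalues i < b := by
      rw [eventually_all]
      exact fun i => eventually_gt_atTop _
    exact (h1.and (eventually_gt_atTop a)).exists
  obtain ⟨C, hC, hC0⟩ : ∃ C : ℝ, (∀ i, |hH.eigenvalues i| ≤ C) ∧ 0 ≤ C := by
    have h1 : ∀ᶠ b : ℝ in atTop, ∀ i, |hH.eigenvalues i| ≤ b := by
      rw [eventually_all]
      exact fun i => eventually_ge_atTop _
    exact (h1.and (eventually_ge_atTop 0)).exists
  have hH1 := (le_eigenvalues_iff hH (-C)).1 fun i => (abs_le.1 (hC i)).1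
  have hH2 := (eigenvalues_le_iff hH C).1 fun i => (abs_le.1 (hC i)).2
  have hA1 := (le_eigenvalues_iff hA.1 a).1 fun i => (ha i).le
  have hA2 := (eigenvalues_le_iff hA.1 b).1 fun i => (hb i).le
  have hone : (1 : Matrix d d ℂ).PosSemidef := PosSemidef.one
  refine ⟨a / 2, b + a, by linarith, by linarith,
    fun i => ⟨by linarith [ha i], by linarith [hb i]⟩, ?_⟩
  have hsmall : ∀ᶠ t : ℝ in 𝓝[>] 0, t * C < a / 2 := by
    have : Tendsto (fun t : ℝ => t * C) (𝓝 0) (𝓝 (0 * C)) := Continuous.tendsto (by fun_prop) 0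
    rw [zero_mul] at this
    exact (this.mono_left nhdsWithin_le_nhds).eventually_lt_const (by linarith)
  filter_upwards [hsmall, self_mem_nhdsWithin] with t ht ht0
  have ht0 : 0 ≤ t := le_of_lt ht0
  refine ⟨fun i => ⟨?_, ?_⟩, fun i => ⟨?_, ?_⟩⟩ <;> revert i
  · rw [le_eigenvalues_iff]
    convert (hA1.add (hH1.smul ht0)).add (hone.smul (show 0 ≤ a / 2 - t * C by linarith)) using 1
    module
  · rw [eigenvalues_le_iff]
    convert (hA2.add (hH2.smul ht0)).add (hone.smul (show 0 ≤ a - t * C by linarith)) using 1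
    module
  · rw [le_eigenvalues_iff]
    convert (hA1.add (hH2.smul ht0)).add (hone.smul (show 0 ≤ a / 2 - t * C by linarith)) using 1
    module
  · rw [eigenvalues_le_iff]
    convert (hA2.add (hH1.smul ht0)).add (hone.smul (show 0 ≤ a - t * C by linarith)) using 1
    module

theorem trFn_pow {d : Type} [Fintype d] [DecidableEq d] {A : Matrix d d ℂ}
    (hA : A.IsHermitian) (k : ℕ) : trFn (fun x => x ^ k) A = (A ^ k).trace.re := by
  have h1 := congrArg (· ^ k) hA.spectral_theorem
  simp only [← map_pow, diagonal_pow] at h1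
  rw [h1, Unitary.conjStarAlgAut_apply, trace_mul_cycle, Unitary.coe_star_mul_self, one_mul,
    trace_diagonal, trFn, dif_pos hA, Complex.re_sum]
  refine Finset.sum_congr rfl fun i _ => ?_
  simp [← Complex.ofReal_pow]

section
attribute [local instance] Matrix.linftyOpNormedRing Matrix.linftyOpNormedAlgebra

theorem hasDerivAt_trace_re {d : Type} [Fintype d] [DecidableEq d] {M : ℝ → Matrix d d ℂ}
    {M' : Matrix d d ℂ} {t : ℝ} (h : HasDerivAt M M' t) :
    HasDerivAt (fun s => (M s).trace.re) M'.trace.re t := by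
  let L : Matrix d d ℂ →ₗ[ℝ] ℝ := Complex.reLm ∘ₗ (traceLinearMap d ℝ ℂ)
  exact (LinearMap.toContinuousLinearMap L).hasFDerivAt.comp_hasDerivAt t h

theorem hasDerivAt_add_smul_pow {d : Type} [Fintype d] [DecidableEq d] (A H : Matrix d d ℂ)
    (k : ℕ) (t : ℝ) :
    HasDerivAt (fun s : ℝ => (A + s • H) ^ k)
      (∑ i ∈ Finset.range k, (A + t • H) ^ (k.pred - i) * H * (A + t • H) ^ i) t := by
  have : HasDerivAt (fun s : ℝ => A + s • H) H t := by
    have h := ((hasDerivAt_id t).smul_const H).const_add A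
    rw [one_smul] at h
    exact h
  exact this.fun_pow' k

theorem tendsto_trace_pow_second_difference {d : Type} [Fintype d] [DecidableEq d]
    (A H : Matrix d d ℂ) (k : ℕ) :
    Tendsto (fun t : ℝ => (((A + t • H) ^ k).trace.re + ((A + (-t) • H) ^ k).trace.re
      - 2 * (A ^ k).trace.re) / t ^ 2) (𝓝[>] 0)
      (𝓝 (k * ∑ i ∈ Finset.range (k - 1), (A ^ (k - 1 - 1 - i) * H * A ^ i * H).trace.re)) := by
  have h1 : ∀ t : ℝ, HasDerivAt (fun s : ℝ => ((A + s • H) ^ k).trace.re)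
      (k * ((A + t • H) ^ (k - 1) * H).trace.re) t := by
    intro t
    convert hasDerivAt_trace_re (hasDerivAt_add_smul_pow A H k t) using 1
    rw [trace_sum, Complex.re_sum]
    rw [Finset.sum_congr rfl (g := fun _ => ((A + t • H) ^ (k - 1) * H).trace.re)]
    · simp
    · intro i hi
      rw [trace_mul_comm, ← mul_assoc, ← pow_add]
      have := Finset.mem_range.1 hi
      congr 5
      simp only [Nat.pred_eq_sub_one]
      omega
  have h2 : HasDerivAt (fun t : ℝ => k * ((A + t • H) ^ (k - 1) * H).trace.re)
      (k * ∑ i ∈ Finset.range (k - 1), (A ^ (k - 1 - 1 - i) * H * A ^ i * H).trace.re) 0 := by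
    have := (hasDerivAt_trace_re ((hasDerivAt_add_smul_pow A H (k - 1) 0).mul_const H)).const_mul
      (k : ℝ)
    simpa [Finset.sum_mul, trace_sum] using this
  have := tendsto_symm_second_difference (Eventually.of_forall h1) h2
  simpa using this

end

theorem divDiff_add {g₁ g₂ : ℝ → ℝ} {x : ℝ} (h₁ : DifferentiableAt ℝ g₁ x)
    (h₂ : DifferentiableAt ℝ g₂ x) (y : ℝ) :
    divDiff (fun z => g₁ z + g₂ z) x y = divDiff g₁ x y + divDiff g₂ x y := by
  unfold divDiff
  split_ifs
  · exact deriv_fun_add h₁ h₂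
  · ring

theorem divDiff_const_mul (c : ℝ) (g : ℝ → ℝ) (x y : ℝ) :
    divDiff (fun z => c * g z) x y = c * divDiff g x y := by
  unfold divDiff
  split_ifs
  · exact deriv_const_mul_field c
  · ring

theorem divDiff_deriv_pow (k : ℕ) (x y : ℝ) :
    divDiff (deriv fun z : ℝ => z ^ k) x y
      = k * ∑ i ∈ Finset.range (k - 1), x ^ (k - 1 - 1 - i) * y ^ i := by
  have h : (deriv fun z : ℝ => z ^ k) = fun z => (k : ℝ) * z ^ (k - 1) := by ext z; simp
  rw [h, divDiff_const_mul]
  congr 1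
  unfold divDiff
  split_ifs with hxy
  · subst hxy
    rw [Finset.sum_congr rfl (g := fun _ => x ^ (k - 1 - 1))]
    · simp
    · intro i hi
      have := Finset.mem_range.1 hi
      rw [← pow_add]
      congr 1
      omega
  · rw [div_eq_iff (sub_ne_zero.2 hxy), ← neg_inj, ← mul_neg, neg_sub, neg_sub,
      ← Commute.geom_sum₂_mul (Commute.all y x) (k - 1)]
    congr 1
    exact Finset.sum_congr rfl fun i _ => mul_comm _ _

theorem trace_diagonal_pow_mul {d : Type} [Fintype d] [DecidableEq d] (x : d → ℝ)
    {H : Matrix d d ℂ} (hH : H.IsHermitian) (a b : ℕ) :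
    ((Matrix.diagonal fun i => (x i : ℂ)) ^ a * H * (Matrix.diagonal fun i => (x i : ℂ)) ^ b *
      H).trace.re = ∑ i, ∑ j, x i ^ a * x j ^ b * Complex.normSq (H i j) := by
  simp only [diagonal_pow, trace, diag_apply, Complex.re_sum]
  refine Finset.sum_congr rfl fun i _ => ?_
  rw [mul_apply, Complex.re_sum]
  refine Finset.sum_congr rfl fun j _ => ?_
  rw [mul_diagonal, diagonal_mul, ← hH.apply j i]
  simp only [Pi.pow_apply, ← Complex.ofReal_pow, RCLike.star_def, Complex.mul_re, Complex.mul_im,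
    Complex.conj_re, Complex.conj_im, Complex.ofReal_re, Complex.ofReal_im, Complex.normSq_apply]
  ring

/-- The symmetric second difference of `A ↦ Tr f(A)` in the direction `H`. -/
def trFnSecondDiff (f : ℝ → ℝ) {d : Type} [Fintype d] [DecidableEq d] (A H : Matrix d d ℂ)
    (t : ℝ) : ℝ :=
  trFn f (A + t • H) + trFn f (A + (-t) • H) - 2 * trFn f A

theorem trFn_add {d : Type} [Fintype d] [DecidableEq d] (f g : ℝ → ℝ) (A : Matrix d d ℂ) :
    trFn (fun x => f x + g x) A = trFn f A + trFn g A := by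
  unfold trFn
  split_ifs <;> simp [Finset.sum_add_distrib]

theorem trFn_const_mul {d : Type} [Fintype d] [DecidableEq d] (c : ℝ) (f : ℝ → ℝ)
    (A : Matrix d d ℂ) : trFn (fun x => c * f x) A = c * trFn f A := by
  unfold trFn
  split_ifs <;> simp [Finset.mul_sum]

theorem trFnSecondDiff_add {d : Type} [Fintype d] [DecidableEq d] (f g : ℝ → ℝ)
    (A H : Matrix d d ℂ) (t : ℝ) : trFnSecondDiff (fun x => f x + g x) A H t
      = trFnSecondDiff f A H t + trFnSecondDiff g A H t := by
  simp only [trFnSecondDiff, trFn_add]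
  ring

theorem trFnSecondDiff_const_mul {d : Type} [Fintype d] [DecidableEq d] (c : ℝ) (f : ℝ → ℝ)
    (A H : Matrix d d ℂ) (t : ℝ) : trFnSecondDiff (fun x => c * f x) A H t
      = c * trFnSecondDiff f A H t := by
  simp only [trFnSecondDiff, trFn_const_mul]
  ring

/-- The quadratic form `Tr h* dg(ρ) h` of the Fréchet differential at a diagonal matrix `ρ`. -/
def divDiffForm (g : ℝ → ℝ) {d : Type} [Fintype d] (x : d → ℝ) (H : Matrix d d ℂ) : ℝ :=
  ∑ i, ∑ j, divDiff g (x i) (x j) * Complex.normSq (H i j)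

theorem tendsto_trFnSecondDiff_polynomial {d : Type} [Fintype d] [DecidableEq d] (x : d → ℝ)
    {H : Matrix d d ℂ} (hH : H.IsHermitian) (p : Polynomial ℝ) :
    Tendsto (fun t => trFnSecondDiff (fun z => p.eval z) (Matrix.diagonal fun i => (x i : ℂ)) H t
        / t ^ 2) (𝓝[>] 0) (𝓝 (divDiffForm (deriv fun z => p.eval z) x H)) := by
  have hA : (Matrix.diagonal fun i => (x i : ℂ)).IsHermitian :=
    isHermitian_diagonal_iff.2 fun i => by simp [IsSelfAdjoint]
  induction p using Polynomial.induction_on' with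
  | add p q hp hq =>
    have hd : (deriv fun z => (p + q).eval z)
        = fun z => deriv (fun z => p.eval z) z + deriv (fun z => q.eval z) z := by
      ext z
      simp only [Polynomial.eval_add]
      exact deriv_fun_add p.differentiableAt q.differentiableAt
    have hdiff : ∀ (r : Polynomial ℝ) (z : ℝ),
        DifferentiableAt ℝ (deriv fun z => r.eval z) z := fun r z => by
      have : (deriv fun z => r.eval z) = fun z => (Polynomial.derivative r).eval z := by
        ext z; exact r.deriv
      rw [this]
      exact Polynomial.differentiableAt _
    have e : divDiffForm (deriv fun z => (p + q).eval z) x H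
        = divDiffForm (deriv fun z => p.eval z) x H
          + divDiffForm (deriv fun z => q.eval z) x H := by
      simp only [divDiffForm, hd, ← Finset.sum_add_distrib, ← add_mul]
      refine Finset.sum_congr rfl fun i _ => Finset.sum_congr rfl fun j _ => ?_
      rw [divDiff_add (hdiff p _) (hdiff q _)]
    rw [e]
    refine (hp.add hq).congr fun t => ?_
    simp only [Polynomial.eval_add, trFnSecondDiff_add, add_div]
  | monomial k c =>
    simp only [Polynomial.eval_monomial, trFnSecondDiff_const_mul, mul_div_assoc]
    have hd : (deriv fun z : ℝ => c * z ^ k) = fun z => c * deriv (fun z : ℝ => z ^ k) z := by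
      ext z; simp
    have e : divDiffForm (deriv fun z : ℝ => c * z ^ k) x H
        = c * divDiffForm (deriv fun z : ℝ => z ^ k) x H := by
      simp only [divDiffForm, hd, divDiff_const_mul, Finset.mul_sum, mul_assoc]
    rw [e]
    refine Tendsto.const_mul c ?_
    have := tendsto_trace_pow_second_difference (Matrix.diagonal fun i => (x i : ℂ)) H k
    convert this using 2
    · simp only [trFnSecondDiff, trFn_pow hA, trFn_pow (isHermitian_add_smul hA hH _)]
    · simp only [divDiffForm, divDiff_deriv_pow, trace_diagonal_pow_mul x hH]
      rw [Finset.sum_comm' (t' := Finset.univ) (s' := fun _ => Finset.range (k - 1)) (by simp)]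
      simp only [Finset.mul_sum, Finset.sum_mul]
      refine Finset.sum_congr rfl fun i _ => ?_
      rw [Finset.sum_comm]
      refine Finset.sum_congr rfl fun l _ => Finset.sum_congr rfl fun j _ => ?_
      ring

theorem exists_derivative_derivative_eq (r : Polynomial ℝ) :
    ∃ p : Polynomial ℝ, Polynomial.derivative (Polynomial.derivative p) = r := by
  have hs : Function.Surjective (Polynomial.derivative : Polynomial ℝ → Polynomial ℝ) := by
    intro r
    induction r using Polynomial.induction_on' with
    | add p q hp hq =>
      obtain ⟨p', rfl⟩ := hp
      obtain ⟨q', rfl⟩ := hq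
      exact ⟨p' + q', Polynomial.derivative_add⟩
    | monomial k c =>
      refine ⟨Polynomial.monomial (k + 1) (c / (k + 1)), ?_⟩
      rw [Polynomial.derivative_monomial]
      have : (k : ℝ) + 1 ≠ 0 := by positivity
      simp [this]
  obtain ⟨p, hp⟩ := hs r
  obtain ⟨p', hp'⟩ := hs p
  exact ⟨p', by rw [hp', hp]⟩

theorem abs_divDiff_sub_le {g₁ g₂ g₁' g₂' : ℝ → ℝ} {a b δ : ℝ}
    (h₁ : ∀ x ∈ Icc a b, HasDerivAt g₁ (g₁' x) x) (h₂ : ∀ x ∈ Icc a b, HasDerivAt g₂ (g₂' x) x)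
    (h : ∀ x ∈ Icc a b, |g₁' x - g₂' x| ≤ δ) {x y : ℝ} (hx : x ∈ Icc a b) (hy : y ∈ Icc a b) :
    |divDiff g₁ x y - divDiff g₂ x y| ≤ δ := by
  unfold divDiff
  split_ifs with hxy
  · rw [(h₁ x hx).deriv, (h₂ x hx).deriv]
    exact h x hx
  · have := (convex_Icc a b).norm_image_sub_le_of_norm_hasDerivWithin_le
      (f := fun z => g₁ z - g₂ z) (fun z hz => ((h₁ z hz).sub (h₂ z hz)).hasDerivWithinAt)
      h hy hx
    simp only [Real.norm_eq_abs] at this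
    rw [← sub_div, abs_div, div_le_iff₀ (abs_pos.2 (sub_ne_zero.2 hxy))]
    rw [show g₁ x - g₁ y - (g₂ x - g₂ y) = g₁ x - g₂ x - (g₁ y - g₂ y) by ring]
    exact this

theorem convexOn_of_hasDerivAt2_nonneg {φ φ' φ'' : ℝ → ℝ} {a b : ℝ}
    (h₁ : ∀ x ∈ Icc a b, HasDerivAt φ (φ' x) x) (h₂ : ∀ x ∈ Icc a b, HasDerivAt φ' (φ'' x) x)
    (h : ∀ x ∈ Icc a b, 0 ≤ φ'' x) : ConvexOn ℝ (Icc a b) φ :=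
  convexOn_of_hasDerivWithinAt2_nonneg (convex_Icc a b)
    (fun x hx => (h₁ x hx).continuousAt.continuousWithinAt)
    (fun x hx => (h₁ x (interior_subset hx)).hasDerivWithinAt)
    (fun x hx => (h₂ x (interior_subset hx)).hasDerivWithinAt)
    (fun x hx => h x (interior_subset hx))

theorem divDiff_id (x y : ℝ) : divDiff (fun z => z) x y = 1 := by
  unfold divDiff
  split_ifs with h
  · simp
  · exact div_self (sub_ne_zero.2 h)

/-- The second derivative of `A ↦ Tr f(A)` at a positive definite diagonal matrix. -/
theorem tendsto_trFnSecondDiff_diagonal {d : Type} [Fintype d] [DecidableEq d] {f q : ℝ → ℝ}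
    (hq : ContinuousOn q (Ioi 0))
    (hf : ∀ x > 0, DifferentiableAt ℝ f x ∧ HasDerivAt (deriv f) (q x) x)
    {x : d → ℝ} (hx : ∀ i, 0 < x i) {H : Matrix d d ℂ} (hH : H.IsHermitian) :
    Tendsto (fun t => trFnSecondDiff f (Matrix.diagonal fun i => (x i : ℂ)) H t / t ^ 2)
      (𝓝[>] 0) (𝓝 (divDiffForm (deriv f) x H)) := by
  set A : Matrix d d ℂ := Matrix.diagonal fun i => (x i : ℂ) with hAdef
  have hA : A.PosDef := PosDef.diagonal fun i => by simpa using hx i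
  obtain ⟨a, b, ha, hab, hAab, hev⟩ := exists_Icc_eigenvalues_add_smul hA hH
  have hnonneg : ∀ φ : ℝ → ℝ, ConvexOn ℝ (Icc a b) φ →
      ∀ᶠ t in 𝓝[>] 0, 0 ≤ trFnSecondDiff φ A H t := by
    intro φ hφ
    filter_upwards [hev] with t ht
    have := trFn_midpoint_le hφ (isHermitian_add_smul hA.1 hH t)
      (isHermitian_add_smul hA.1 hH (-t)) hA.1 ht.1 ht.2 (by module)
    unfold trFnSecondDiff
    linarith
  have hpoly : ∀ (p : Polynomial ℝ) (z : ℝ),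
      HasDerivAt (fun z => p.eval z) ((Polynomial.derivative p).eval z) z :=
    fun p z => p.hasDerivAt z
  have hxab : ∀ i, x i ∈ Icc a b := by
    intro i
    have h1 := (le_eigenvalues_iff hA.1 a).1 fun i => (hAab i).1
    have h2 := (eigenvalues_le_iff hA.1 b).1 fun i => (hAab i).2
    have e1 := h1.diag_nonneg (i := i)
    have e2 := h2.diag_nonneg (i := i)
    simp only [hAdef, Matrix.sub_apply, Matrix.smul_apply, diagonal_apply_eq, one_apply_eq,
      Complex.real_smul, mul_one, ← Complex.ofReal_sub, Complex.zero_le_real, sub_nonneg] at e1 e2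
    exact ⟨e1, e2⟩
  set e : Polynomial ℝ := Polynomial.C (1 / 2) * Polynomial.X ^ 2 with he
  have he1 : Polynomial.derivative e = Polynomial.X := by
    rw [he, Polynomial.derivative_C_mul_X_pow]
    norm_num
  set N := ∑ i, ∑ j, Complex.normSq (H i j) with hN
  have hN0 : 0 ≤ N := Finset.sum_nonneg fun i _ => Finset.sum_nonneg fun j _ =>
    Complex.normSq_nonneg _
  have heN : divDiffForm (deriv fun z => e.eval z) x H = N := by
    have : (deriv fun z => e.eval z) = fun z => z := by
      ext z
      rw [(hpoly e z).deriv, he1, Polynomial.eval_X]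
    simp only [divDiffForm, this, divDiff_id, one_mul, hN]
  have hlime := tendsto_trFnSecondDiff_polynomial x hH e
  rw [heN] at hlime
  rw [Metric.tendsto_nhds]
  intro η hη
  set δ := η / (3 * (N + 1)) with hδ
  have hδ0 : 0 < δ := by positivity
  have hδN : δ * (N + 1) = η / 3 := by rw [hδ]; field_simp
  have hab0 : Icc a b ⊆ Ioi 0 := fun y hy => lt_of_lt_of_le ha hy.1
  obtain ⟨r, hr⟩ := exists_polynomial_near_of_continuousOn a b q (hq.mono hab0) δ hδ0
  obtain ⟨p, rfl⟩ := exists_derivative_derivative_eq r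
  have hlimp := tendsto_trFnSecondDiff_polynomial x hH p
  have hderivp : (deriv fun z => p.eval z) = fun z => (Polynomial.derivative p).eval z := by
    ext z; exact p.deriv
  have hform : |divDiffForm (deriv fun z => p.eval z) x H - divDiffForm (deriv f) x H|
      ≤ δ * N := by
    simp only [divDiffForm, ← Finset.sum_sub_distrib, hN, Finset.mul_sum]
    refine (Finset.abs_sum_le_sum_abs _ _).trans (Finset.sum_le_sum fun i _ => ?_)
    refine (Finset.abs_sum_le_sum_abs _ _).trans (Finset.sum_le_sum fun j _ => ?_)
    rw [← sub_mul, abs_mul, abs_of_nonneg (Complex.normSq_nonneg _)]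
    refine mul_le_mul_of_nonneg_right ?_ (Complex.normSq_nonneg _)
    rw [hderivp]
    exact abs_divDiff_sub_le (fun z _ => hpoly _ z) (fun z hz => (hf z (hab0 hz)).2)
      (fun z hz => (hr z hz).le) (hxab i) (hxab j)
  have hcomp : ∀ s : ℝ, |s| = 1 → ∀ᶠ t in 𝓝[>] 0,
      0 ≤ δ * trFnSecondDiff (fun z => e.eval z) A H t
        + s * (trFnSecondDiff f A H t - trFnSecondDiff (fun z => p.eval z) A H t) := by
    intro s hs
    have hconv : ConvexOn ℝ (Icc a b) (fun z => δ * e.eval z + s * (f z + -1 * p.eval z)) := by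
      refine convexOn_of_hasDerivAt2_nonneg
        (φ' := fun z => δ * z + s * (deriv f z + -1 * (Polynomial.derivative p).eval z))
        (φ'' := fun z => δ * 1 + s * (q z +
          -1 * (Polynomial.derivative (Polynomial.derivative p)).eval z)) ?_ ?_ ?_
      · intro z hz
        have h1 := hpoly e z
        rw [he1, Polynomial.eval_X] at h1
        exact (h1.const_mul δ).fun_add (((hf z (hab0 hz)).1.hasDerivAt.fun_add
          ((hpoly p z).const_mul (-1))).const_mul s)
      · intro z hz
        exact ((hasDerivAt_id z).const_mul δ).fun_add (((hf z (hab0 hz)).2.fun_add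
          ((hpoly _ z).const_mul (-1))).const_mul s)
      · intro z hz
        have h1 := (hr z hz).le
        rw [← one_mul |_|, ← hs, ← abs_mul] at h1
        have := (abs_le.1 h1).2
        linarith
    filter_upwards [hnonneg _ hconv] with t ht
    rw [trFnSecondDiff_add, trFnSecondDiff_const_mul, trFnSecondDiff_const_mul,
      trFnSecondDiff_add, trFnSecondDiff_const_mul] at ht
    linarith
  filter_upwards [hcomp 1 (by simp), hcomp (-1) (by simp),
    hlime.eventually_lt_const (show N < N + 1 by linarith),
    (Metric.tendsto_nhds.1 hlimp) (η / 3) (by linarith), self_mem_nhdsWithin]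
    with t h1 h2 h3 h4 ht
  rw [Real.dist_eq] at h4 ⊢
  have ht2 : 0 < t ^ 2 := pow_pos ht 2
  have h5 : |trFnSecondDiff f A H t / t ^ 2 - trFnSecondDiff (fun z => p.eval z) A H t / t ^ 2|
      ≤ δ * (N + 1) := by
    rw [← sub_div, abs_div, abs_of_pos ht2, div_le_iff₀ ht2]
    rw [div_lt_iff₀ ht2] at h3
    have h6 := mul_le_mul_of_nonneg_left h3.le hδ0.le
    rw [abs_le]
    constructor <;> linarith
  have h6 : δ * N ≤ δ * (N + 1) := mul_le_mul_of_nonneg_left (by linarith) hδ0.le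
  rw [hδN] at h5 h6
  have h7 := hform.trans h6
  rw [abs_le] at h5 h7
  rw [abs_lt] at h4 ⊢
  constructor <;> linarith

theorem posDef_of_charpoly {d ι : Type} [Fintype d] [DecidableEq d] [Fintype ι]
    {A : Matrix d d ℂ} (hA : A.IsHermitian) {x : ι → ℝ} (hx : ∀ i, 0 < x i)
    (h : A.charpoly = ∏ i, (Polynomial.X - Polynomial.C (x i : ℂ))) : A.PosDef := by
  refine hA.posDef_iff_eigenvalues_pos.2 fun i => ?_
  have h1 : A.charpoly.eval (hA.eigenvalues i : ℂ) = 0 := by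
    rw [hA.charpoly_eq, Polynomial.eval_prod]
    exact Finset.prod_eq_zero (Finset.mem_univ i) (by simp)
  rw [h, Polynomial.eval_prod, Finset.prod_eq_zero_iff] at h1
  obtain ⟨j, -, hj⟩ := h1
  simp only [Polynomial.eval_sub, Polynomial.eval_X, Polynomial.eval_C, sub_eq_zero,
    Complex.ofReal_inj] at hj
  exact hj ▸ hx j

theorem trFn_add_smul_one {d : Type} [Fintype d] [DecidableEq d] (f : ℝ → ℝ) {A : Matrix d d ℂ}
    (hA : A.IsHermitian) (ε : ℝ) :
    trFn f (A + ε • (1 : Matrix d d ℂ)) = ∑ i, f (hA.eigenvalues i + ε) := by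
  have hU := hA.eigenvectorUnitary.2
  rw [← trFn_star_conj f hU (isHermitian_add_smul hA isHermitian_one ε), mul_add, add_mul,
    star_eigenvectorUnitary_conj hA, ← trFn_diagonal]
  congr 1
  rw [mul_smul_comm, mul_one, smul_mul_assoc, mem_unitaryGroup_iff'.1 hU]
  ext i j
  by_cases hij : i = j <;> simp [hij]

theorem tendsto_trFn_add_smul_one {d : Type} [Fintype d] [DecidableEq d] {f : ℝ → ℝ}
    (hf : ContinuousOn f (Ioi 0)) {A : Matrix d d ℂ} (hA : A.PosDef) :
    Tendsto (fun ε : ℝ => trFn f (A + ε • (1 : Matrix d d ℂ))) (𝓝[>] 0) (𝓝 (trFn f A)) := by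
  simp_rw [trFn_add_smul_one f hA.1]
  rw [trFn, dif_pos hA.1]
  refine tendsto_finsetSum _ fun i _ => ?_
  have h1 := (hf.continuousAt (Ioi_mem_nhds (hA.eigenvalues_pos i))).tendsto
  refine h1.comp (tendsto_nhdsWithin_of_tendsto_nhds ?_)
  exact (continuous_const.add continuous_id).tendsto' _ _ (by simp)

theorem charpoly_smul_one {d : Type} [Fintype d] [DecidableEq d] (ε : ℝ) :
    (ε • (1 : Matrix d d ℂ)).charpoly = ∏ _i : d, (Polynomial.X - Polynomial.C (ε : ℂ)) := by
  rw [← charpoly_diagonal]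
  congr 1
  ext i j
  by_cases hij : i = j <;> simp [hij]

/-- The conjugate of `A ⊕ ε` by the unitary `2 ^ (-1/2) [1, 1; 1, -1]`. -/
def hadamardDilation {d : Type} [DecidableEq d] (ε : ℝ) (A : Matrix d d ℂ) :
    Matrix (d ⊕ d) (d ⊕ d) ℂ :=
  fromBlocks ((1 / 2 : ℝ) • (A + ε • 1)) ((1 / 2 : ℝ) • (A - ε • 1))
    ((1 / 2 : ℝ) • (A - ε • 1)) ((1 / 2 : ℝ) • (A + ε • 1))

theorem isHermitian_hadamardDilation {d : Type} [DecidableEq d] (ε : ℝ) {A : Matrix d d ℂ}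
    (hA : A.IsHermitian) : (hadamardDilation ε A).IsHermitian := by
  have h1 : (ε • (1 : Matrix d d ℂ)).IsHermitian := isHermitian_one.smul (IsSelfAdjoint.all ε)
  have h2 := (hA.add h1).smul (IsSelfAdjoint.all (1 / 2 : ℝ))
  have h3 := (hA.sub h1).smul (IsSelfAdjoint.all (1 / 2 : ℝ))
  exact h2.fromBlocks h3 h2

theorem charpoly_hadamardDilation {d : Type} [Fintype d] [DecidableEq d] (ε : ℝ)
    (A : Matrix d d ℂ) :
    (hadamardDilation ε A).charpoly = A.charpoly * (ε • (1 : Matrix d d ℂ)).charpoly := by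
  have h1 : hadamardDilation ε A = fromBlocks 1 1 1 (-1) *
      (fromBlocks A 0 0 (ε • 1) * ((1 / 2 : ℝ) • fromBlocks 1 1 1 (-1))) := by
    simp only [hadamardDilation, fromBlocks_smul, fromBlocks_multiply]
    simp [smul_add, sub_eq_add_neg]
  have h2 : ((1 / 2 : ℝ) • fromBlocks 1 1 1 (-1) : Matrix (d ⊕ d) (d ⊕ d) ℂ) *
      fromBlocks 1 1 1 (-1) = 1 := by
    rw [smul_mul_assoc, fromBlocks_multiply, fromBlocks_smul, ← fromBlocks_one]
    congr 1 <;> simp [← two_smul ℝ, smul_smul]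
  rw [h1, charpoly_mul_comm, mul_assoc, h2, mul_one, charpoly_fromBlocks_zero₁₂]

/-- Regrouping of `(ℂᵈ ⊕ ℂᵈ) ⊗ ℂ²` as a sum of two copies of `ℂᵈ ⊕ ℂᵈ`, each having one summand in
each of the two copies of `ℂᵈ ⊕ ℂᵈ` in the tensor product. -/
def crossSumEquiv (d : Type) : (d ⊕ d) × Fin 2 ≃ (d ⊕ d) ⊕ (d ⊕ d) where
  toFun
    | (.inl k, 0) => .inl (.inl k)
    | (.inr k, 0) => .inr (.inr k)
    | (.inl k, 1) => .inr (.inl k)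
    | (.inr k, 1) => .inl (.inr k)
  invFun
    | .inl (.inl k) => (.inl k, 0)
    | .inr (.inr k) => (.inr k, 0)
    | .inr (.inl k) => (.inl k, 1)
    | .inl (.inr k) => (.inr k, 1)
  left_inv := by rintro ⟨k | k, b⟩ <;> fin_cases b <;> rfl
  right_inv := by rintro ((k | k) | (k | k)) <;> rfl

def crossEquiv (n : ℕ) : Fin (n + n) × Fin 2 ≃ (Fin n ⊕ Fin n) ⊕ (Fin n ⊕ Fin n) :=
  (finSumFinEquiv.symm.prodCongr (Equiv.refl _)).trans (crossSumEquiv (Fin n))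

/-- A state on `(ℂⁿ ⊕ ℂⁿ) ⊗ ℂ²` whose spectrum is that of `A ⊕ B ⊕ ε ⊕ ε` and whose marginal is the
direct sum of two copies of `(A + B) / 2 + ε`. -/
def crossDilation {n : ℕ} (ε : ℝ) (A B : Matrix (Fin n) (Fin n) ℂ) :
    Matrix (Fin (n + n) × Fin 2) (Fin (n + n) × Fin 2) ℂ :=
  (fromBlocks (hadamardDilation ε A) 0 0 (hadamardDilation ε B)).submatrix
    (crossEquiv n) (crossEquiv n)

theorem crossDilation_combination {n : ℕ} (ε : ℝ) (A B A' B' : Matrix (Fin n) (Fin n) ℂ) {a b : ℝ}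
    (hab : a + b = 1) : crossDilation ε (a • A + b • A') (a • B + b • B')
      = a • crossDilation ε A B + b • crossDilation ε A' B' := by
  have h : ∀ A A' : Matrix (Fin n) (Fin n) ℂ, hadamardDilation ε (a • A + b • A') =
      a • hadamardDilation ε A + b • hadamardDilation ε A' := by
    intro A A'
    obtain rfl : b = 1 - a := by linarith
    simp only [hadamardDilation, fromBlocks_smul, fromBlocks_add]
    congr 1 <;> module
  rw [crossDilation, h, h]
  simp only [crossDilation]
  ext i j
  rcases h1 : crossEquiv n i with k | k <;> rcases h2 : crossEquiv n j with l | l <;>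
    simp [h1, h2]

theorem isHermitian_crossDilation {n : ℕ} (ε : ℝ) {A B : Matrix (Fin n) (Fin n) ℂ}
    (hA : A.IsHermitian) (hB : B.IsHermitian) : (crossDilation ε A B).IsHermitian :=
  ((isHermitian_hadamardDilation ε hA).fromBlocks (by simp)
    (isHermitian_hadamardDilation ε hB)).submatrix _

theorem charpoly_crossDilation {n : ℕ} (ε : ℝ) {A B : Matrix (Fin n) (Fin n) ℂ}
    (hA : A.IsHermitian) (hB : B.IsHermitian) :
    (crossDilation ε A B).charpoly = ∏ i, (Polynomial.X - Polynomial.C ((Sum.elim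
      (Sum.elim hA.eigenvalues fun _ : Fin n => ε) (Sum.elim hB.eigenvalues fun _ : Fin n => ε)
      i : ℝ) : ℂ)) := by
  have h1 : crossDilation ε A B = reindex (crossEquiv n).symm (crossEquiv n).symm
    (fromBlocks (hadamardDilation ε A) 0 0 (hadamardDilation ε B)) := rfl
  rw [h1, charpoly_reindex, charpoly_fromBlocks_zero₁₂, charpoly_hadamardDilation,
    charpoly_hadamardDilation, charpoly_smul_one, hA.charpoly_eq, hB.charpoly_eq]
  simp [Fintype.prod_sum_type]

theorem posDef_crossDilation {n : ℕ} {ε : ℝ} (hε : 0 < ε) {A B : Matrix (Fin n) (Fin n) ℂ}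
    (hA : A.PosDef) (hB : B.PosDef) : (crossDilation ε A B).PosDef := by
  refine posDef_of_charpoly (isHermitian_crossDilation ε hA.1 hB.1) ?_
    (charpoly_crossDilation ε hA.1 hB.1)
  rintro ((i | i) | (i | i))
  exacts [hA.eigenvalues_pos i, hε, hB.eigenvalues_pos i, hε]

theorem trFn_crossDilation (f : ℝ → ℝ) {n : ℕ} (ε : ℝ) {A B : Matrix (Fin n) (Fin n) ℂ}
    (hA : A.IsHermitian) (hB : B.IsHermitian) :
    trFn f (crossDilation ε A B) = trFn f A + trFn f B + 2 * (n * f ε) := by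
  rw [trFn_eq_sum_of_charpoly f (isHermitian_crossDilation ε hA hB)
    (charpoly_crossDilation ε hA hB), trFn, trFn, dif_pos hA, dif_pos hB]
  simp [Fintype.sum_sum_type]
  ring

theorem partialTrace_crossDilation {n : ℕ} (ε : ℝ) (A B : Matrix (Fin n) (Fin n) ℂ) :
    partialTrace (crossDilation ε A B) = reindex finSumFinEquiv finSumFinEquiv
      (fromBlocks ((1 / 2 : ℝ) • (A + B) + ε • 1) 0 0 ((1 / 2 : ℝ) • (A + B) + ε • 1)) := by
  have h1 : ((1 / 2 : ℝ) • (A + ε • 1) + (1 / 2 : ℝ) • (B + ε • 1) : Matrix (Fin n) (Fin n) ℂ)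
    = (1 / 2 : ℝ) • (A + B) + ε • 1 := by module
  ext i j
  obtain ⟨i, rfl⟩ := finSumFinEquiv.surjective i
  obtain ⟨j, rfl⟩ := finSumFinEquiv.surjective j
  rw [← h1]
  rcases i with i | i <;> rcases j with j | j <;>
    simp [partialTrace, crossDilation, crossEquiv, crossSumEquiv, hadamardDilation,
      -finSumFinEquiv_apply_left, -finSumFinEquiv_apply_right]
  ring

theorem trFn_partialTrace_crossDilation (f : ℝ → ℝ) {n : ℕ} (ε : ℝ)
    {A B : Matrix (Fin n) (Fin n) ℂ} (hA : A.IsHermitian) (hB : B.IsHermitian) :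
    trFn f (partialTrace (crossDilation ε A B)) = 2 * trFn f ((1 / 2 : ℝ) • (A + B) + ε • 1) := by
  have hM := isHermitian_add_smul ((hA.add hB).smul (IsSelfAdjoint.all (1 / 2 : ℝ)))
    isHermitian_one ε
  rw [partialTrace_crossDilation, reindex_apply,
    trFn_eq_sum_of_charpoly f (x := Sum.elim hM.eigenvalues hM.eigenvalues)
      ((hM.fromBlocks conjTranspose_zero hM).submatrix _), trFn, dif_pos hM]
  · simp [Fintype.sum_sum_type]
    ring
  · rw [← reindex_apply, charpoly_reindex, charpoly_fromBlocks_zero₁₂, hM.charpoly_eq]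
    simp [Fintype.prod_sum_type]

theorem convex_setOf_posDef {d : Type} : Convex ℝ {A : Matrix d d ℂ | A.PosDef} := by
  intro A hA B hB a b ha hb hab
  rcases ha.eq_or_lt with rfl | ha
  · obtain rfl : b = 1 := by linarith
    simpa using hB
  · exact (PosDef.smul hA ha).add_posSemidef (hB.posSemidef.smul hb)

/-- The Jensen gap of `Tr f` for an entropic function is jointly convex. -/
theorem IsEntropic.convexOn_jensenGap {f : ℝ → ℝ} (hf : IsEntropic f) (n : ℕ) :
    ConvexOn ℝ {p : Matrix (Fin n) (Fin n) ℂ × Matrix (Fin n) (Fin n) ℂ | p.1.PosDef ∧ p.2.PosDef}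
      (fun p => trFn f p.1 + trFn f p.2 - 2 * trFn f ((1 / 2 : ℝ) • (p.1 + p.2))) := by
  have hconv : Convex ℝ {A : Matrix (Fin n) (Fin n) ℂ | A.PosDef} := convex_setOf_posDef
  have hcont : ContinuousOn f (Ioi 0) := hf.1.continuousOn isOpen_Ioi
  have hset : Convex ℝ {p : Matrix (Fin n) (Fin n) ℂ × Matrix (Fin n) (Fin n) ℂ |
    p.1.PosDef ∧ p.2.PosDef} := hconv.prod hconv
  have hlim : ∀ A B : Matrix (Fin n) (Fin n) ℂ, A.PosDef → B.PosDef →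
      Tendsto (fun ε : ℝ => trFn f A + trFn f B - 2 * trFn f ((1 / 2 : ℝ) • (A + B) + ε • 1))
        (𝓝[>] 0) (𝓝 (trFn f A + trFn f B - 2 * trFn f ((1 / 2 : ℝ) • (A + B)))) :=
    fun A B hA hB => tendsto_const_nhds.sub
      ((tendsto_trFn_add_smul_one hcont ((hA.add hB).smul (by norm_num))).const_mul 2)
  refine ⟨hset, ?_⟩
  rintro ⟨A, B⟩ ⟨hA, hB⟩ ⟨A', B'⟩ ⟨hA', hB'⟩ a b ha hb hab
  have hAB := hset (x := (A, B)) ⟨hA, hB⟩ (y := (A', B')) ⟨hA', hB'⟩ ha hb hab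
  refine le_of_tendsto_of_tendsto (hlim _ _ hAB.1 hAB.2)
    (((hlim A B hA hB).const_smul a).add ((hlim A' B' hA' hB').const_smul b)) ?_
  filter_upwards [self_mem_nhdsWithin] with ε hε
  have h := (hf.2 (n + n) 2).2 (posDef_crossDilation hε hA hB) (posDef_crossDilation hε hA' hB')
    ha hb hab
  simp only [Prod.smul_mk, Prod.mk_add_mk] at h hAB ⊢
  rw [← crossDilation_combination ε A B A' B' hab, trFn_crossDilation f ε hAB.1.1 hAB.2.1,
    trFn_crossDilation f ε hA.1 hB.1, trFn_crossDilation f ε hA'.1 hB'.1,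
    trFn_partialTrace_crossDilation f ε hAB.1.1 hAB.2.1,
    trFn_partialTrace_crossDilation f ε hA.1 hB.1,
    trFn_partialTrace_crossDilation f ε hA'.1 hB'.1] at h
  obtain rfl : b = 1 - a := by linarith
  simp only [smul_eq_mul] at h ⊢
  linarith

theorem IsEntropic.convexOn_second_difference {f : ℝ → ℝ} (hf : IsEntropic f) {h : ℝ}
    (hh : 0 < h) : ConvexOn ℝ (Ioi h) (fun x => f (x + h) + f (x - h) - 2 * f x) := by
  let D : ℝ → Matrix (Fin 1) (Fin 1) ℂ := fun x => Matrix.diagonal fun _ => (x : ℂ)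
  have hD : ∀ x, trFn f (D x) = f x := fun x => by
    simpa using trFn_diagonal f fun _ : Fin 1 => x
  have hpos : ∀ x, 0 < x → (D x).PosDef := fun x hx => PosDef.diagonal fun _ => by simpa using hx
  have hlin : ∀ a b x y : ℝ, D (a * x + b * y) = a • D x + b • D y := by
    intro a b x y
    ext i j
    obtain rfl := Subsingleton.elim i j
    simp [D]
  refine ⟨convex_Ioi h, fun x hx y hy a b ha hb hab => ?_⟩
  rw [mem_Ioi] at hx hy
  have key := (hf.convexOn_jensenGap 1).2
    (x := (D (x + h), D (x - h))) ⟨hpos _ (by linarith), hpos _ (by linarith)⟩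
    (y := (D (y + h), D (y - h))) ⟨hpos _ (by linarith), hpos _ (by linarith)⟩ ha hb hab
  have hmid : ∀ x, (1 / 2 : ℝ) • (D (x + h) + D (x - h)) = D x := fun x => by
    rw [smul_add, ← hlin]
    congr 1
    ring
  simp only [Prod.smul_mk, Prod.mk_add_mk, ← hlin, smul_eq_mul] at key ⊢
  rw [show a * (x + h) + b * (y + h) = a * x + b * y + h by linear_combination h * hab,
    show a * (x - h) + b * (y - h) = a * x + b * y - h by linear_combination -h * hab] at key
  simpa only [hmid, hD] using key

theorem trFnSecondDiff_star_conj {d : Type} [Fintype d] [DecidableEq d] (f : ℝ → ℝ)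
    {U : Matrix d d ℂ} (hU : U ∈ unitaryGroup d ℂ) {A H : Matrix d d ℂ} (hA : A.IsHermitian)
    (hH : H.IsHermitian) (t : ℝ) :
    trFnSecondDiff f (star U * A * U) (star U * H * U) t = trFnSecondDiff f A H t := by
  have h : ∀ s : ℝ, star U * A * U + s • (star U * H * U) = star U * (A + s • H) * U := fun s => by
    rw [mul_add, add_mul, mul_smul_comm, smul_mul_assoc]
  rw [trFnSecondDiff, h, h, trFn_star_conj f hU (isHermitian_add_smul hA hH t),
    trFn_star_conj f hU (isHermitian_add_smul hA hH (-t)), trFn_star_conj f hU hA, trFnSecondDiff]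

theorem re_trace_star_mul_frechetDiff (g : ℝ → ℝ) {n : ℕ} {A : Matrix (Fin n) (Fin n) ℂ}
    (hA : A.IsHermitian) (H : Matrix (Fin n) (Fin n) ℂ) :
    (trace (star H * frechetDiff g A H)).re = divDiffForm g hA.eigenvalues
      (star (hA.eigenvectorUnitary : Matrix (Fin n) (Fin n) ℂ) * H * hA.eigenvectorUnitary) := by
  set U := (hA.eigenvectorUnitary : Matrix (Fin n) (Fin n) ℂ) with hU
  set L : Matrix (Fin n) (Fin n) ℂ :=
    Matrix.of fun i j => (divDiff g (hA.eigenvalues i) (hA.eigenvalues j) : ℂ) with hL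
  set K := star U * H * U with hK
  have h1 : frechetDiff g A H = U * ((L ⊙ K) * star U) := by
    rw [frechetDiff, dif_pos hA]
    simp only [LinearMap.comp_apply, conjEnd, LinearMap.mulLeft_apply, LinearMap.mulRight_apply,
      hadamardEnd, LinearMap.coe_mk, AddHom.coe_mk, star_star, ← hU, ← hL, hK, mul_assoc]
  have h2 : trace (star H * frechetDiff g A H) = trace (star K * (L ⊙ K)) := by
    rw [h1, ← mul_assoc, ← mul_assoc, trace_mul_comm]
    simp only [hK, star_mul, star_star, mul_assoc]
  rw [h2, trace, Complex.re_sum, divDiffForm, Finset.sum_comm]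
  refine Finset.sum_congr rfl fun j _ => ?_
  rw [diag_apply, mul_apply, Complex.re_sum]
  refine Finset.sum_congr rfl fun i _ => ?_
  rw [star_apply, hadamard_apply, hL, of_apply, Complex.normSq_apply]
  simp
  ring

theorem tendsto_trFnSecondDiff {n : ℕ} {f q : ℝ → ℝ} (hq : ContinuousOn q (Ioi 0))
    (hf : ∀ x > 0, DifferentiableAt ℝ f x ∧ HasDerivAt (deriv f) (q x) x)
    {A H : Matrix (Fin n) (Fin n) ℂ} (hA : A.PosDef) (hH : H.IsHermitian) :
    Tendsto (fun t => trFnSecondDiff f A H t / t ^ 2) (𝓝[>] 0)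
      (𝓝 (trace (star H * frechetDiff (deriv f) A H)).re) := by
  rw [re_trace_star_mul_frechetDiff _ hA.1]
  have h := tendsto_trFnSecondDiff_diagonal hq hf hA.eigenvalues_pos
    (isHermitian_conjTranspose_mul_mul (hA.1.eigenvectorUnitary : Matrix (Fin n) (Fin n) ℂ) hH)
  simp_rw [← star_eigenvectorUnitary_conj hA.1, ← star_eq_conjTranspose,
    trFnSecondDiff_star_conj f hA.1.eigenvectorUnitary.2 hA.1 hH] at h
  exact h

theorem convex_setOf_isHermitian {d : Type} : Convex ℝ {A : Matrix d d ℂ | A.IsHermitian} :=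
  fun _ hA _ hB a b _ _ _ => (IsHermitian.smul hA (IsSelfAdjoint.all a)).add
    (IsHermitian.smul hB (IsSelfAdjoint.all b))

theorem eventually_posDef_add_smul {d : Type} [Fintype d] [DecidableEq d] {A H : Matrix d d ℂ}
    (hA : A.PosDef) (hH : H.IsHermitian) :
    ∀ᶠ t : ℝ in 𝓝[>] 0, (A + t • H).PosDef ∧ (A + (-t) • H).PosDef := by
  obtain ⟨a, b, ha, -, -, hev⟩ := exists_Icc_eigenvalues_add_smul hA hH
  filter_upwards [hev] with t ht
  exact ⟨(isHermitian_add_smul hA.1 hH t).posDef_iff_eigenvalues_pos.2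
      fun i => ha.trans_le (ht.1 i).1,
    (isHermitian_add_smul hA.1 hH (-t)).posDef_iff_eigenvalues_pos.2
      fun i => ha.trans_le (ht.2 i).1⟩

theorem IsEntropic.trFnSecondDiff_le {f : ℝ → ℝ} (hf : IsEntropic f) {n : ℕ}
    {A H B K : Matrix (Fin n) (Fin n) ℂ} {t a b : ℝ}
    (hA : (A + t • H).PosDef ∧ (A + (-t) • H).PosDef)
    (hB : (B + t • K).PosDef ∧ (B + (-t) • K).PosDef) (ha : 0 ≤ a) (hb : 0 ≤ b)
    (hab : a + b = 1) :
    trFnSecondDiff f (a • A + b • B) (a • H + b • K) t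
      ≤ a * trFnSecondDiff f A H t + b * trFnSecondDiff f B K t := by
  have h := (hf.convexOn_jensenGap n).2 (x := (A + t • H, A + (-t) • H)) hA
    (y := (B + t • K, B + (-t) • K)) hB ha hb hab
  have hlin : ∀ s : ℝ, a • (A + s • H) + b • (B + s • K)
      = a • A + b • B + s • (a • H + b • K) := fun s => by module
  have hmid : ∀ A H : Matrix (Fin n) (Fin n) ℂ,
      (1 / 2 : ℝ) • (A + t • H + (A + (-t) • H)) = A := fun A H => by module
  simpa only [Prod.smul_mk, Prod.mk_add_mk, smul_eq_mul, hlin, hmid, trFnSecondDiff] using h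

end

/-- An entropic function is a matrix entropy: the map
`(ρ, h) ↦ Tr h* df'(ρ) h` is convex in pairs of a positive definite `ρ` and a
self-adjoint `h` on any finite-dimensional Hilbert space. -/
theorem entropic_is_matrix_entropy (f : ℝ → ℝ) (hf : IsEntropic f) :
    ∀ n : ℕ,
      ConvexOn ℝ
        {p : Matrix (Fin n) (Fin n) ℂ × Matrix (Fin n) (Fin n) ℂ |
          p.1.PosDef ∧ p.2.IsHermitian}
        (fun p => (Matrix.trace (star p.2 * frechetDiff (deriv f) p.1 p.2)).re) := by
  intro n
  obtain ⟨q, hq, hfq⟩ := exists_continuousOn_deriv2_of_convexOn_second_difference hf.1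
    fun h hh => hf.convexOn_second_difference hh
  refine ⟨convex_setOf_posDef.prod convex_setOf_isHermitian, ?_⟩
  rintro ⟨A, H⟩ ⟨hA, hH⟩ ⟨B, K⟩ ⟨hB, hK⟩ a b ha hb hab
  have hC := convex_setOf_posDef hA hB ha hb hab
  have hM := convex_setOf_isHermitian hH hK ha hb hab
  refine le_of_tendsto_of_tendsto (tendsto_trFnSecondDiff hq hfq hC hM)
    (((tendsto_trFnSecondDiff hq hfq hA hH).const_smul a).add
      ((tendsto_trFnSecondDiff hq hfq hB hK).const_smul b)) ?_
  filter_upwards [eventually_posDef_add_smul hA hH, eventually_posDef_add_smul hB hK] with t h1 h2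
  have h := hf.trFnSecondDiff_le h1 h2 ha hb hab
  simp only [smul_eq_mul, ← mul_div_assoc, ← add_div]
  exact div_le_div_of_nonneg_right h (sq_nonneg t)

end
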